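/- arXiv:math/0009181 — 2 statements merged into one kernel-verified Lean document; each statement's English description precedes it below -/
import Mathlib

section
/- For all k, l, n ≥ 1 there is a unique A-algebra homomorphism Δ_{k,l,n} : S_q(k,n) → S_q(k,l) ⊗_A S_q(l,n) satisfying Δ_{k,l,n}(X_{ij}) = ∑_{l'=1}^{l} X_{il'} ⊗ X_{l'j} for all 1 ≤ i ≤ k and 1 ≤ j ≤ n. -/
/-- The defining relations of the algebra of functions on quantum `k × n`
matrix space, as a relation on the free algebra on generators
`X_{ij}`, `i ∈ Fin k`, `j ∈ Fin n`. -/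
inductive QMatRel (A : Type*) [CommRing A] (q : Aˣ) (k n : ℕ) :
    FreeAlgebra A (Fin k × Fin n) → FreeAlgebra A (Fin k × Fin n) → Prop
  | comm (i r : Fin k) (j l : Fin n) (h : (i < r ∧ l < j) ∨ (r < i ∧ j < l)) :
      QMatRel A q k n
        (FreeAlgebra.ι A (i, j) * FreeAlgebra.ι A (r, l))
        (FreeAlgebra.ι A (r, l) * FreeAlgebra.ι A (i, j))
  | qcomm (i r : Fin k) (j l : Fin n) (h : (i < r ∧ j = l) ∨ (i = r ∧ j < l)) :
      QMatRel A q k n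
        (FreeAlgebra.ι A (i, j) * FreeAlgebra.ι A (r, l))
        (((q⁻¹ : Aˣ) : A) • (FreeAlgebra.ι A (r, l) * FreeAlgebra.ι A (i, j)))
  | cross (i r : Fin k) (j l : Fin n) (h : i < r ∧ j < l) :
      QMatRel A q k n
        (FreeAlgebra.ι A (i, j) * FreeAlgebra.ι A (r, l))
        (FreeAlgebra.ι A (r, l) * FreeAlgebra.ι A (i, j) -
          ((q : A) - ((q⁻¹ : Aˣ) : A)) •
            (FreeAlgebra.ι A (r, j) * FreeAlgebra.ι A (i, l)))

/-- The algebra `S_q(k,n)` of functions on quantum `k × n` matrix space. -/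
abbrev QMat (A : Type*) [CommRing A] (q : Aˣ) (k n : ℕ) :=
  RingQuot (QMatRel A q k n)

/-- The generator `X_{ij}` of `S_q(k,n)`. -/
noncomputable def QMat.X (A : Type*) [CommRing A] (q : Aˣ) (k n : ℕ)
    (i : Fin k) (j : Fin n) : QMat A q k n :=
  RingQuot.mkAlgHom A (QMatRel A q k n) (FreeAlgebra.ι A (i, j))

/-- The ordered monomial `X^m = ∏_j ∏_i X_{ij}^{m_{ij}}`, the factors ordered by
increasing column index `j` and, within each column, by increasing row index. -/
noncomputable def QMat.monomial (A : Type*) [CommRing A] (q : Aˣ) (k n : ℕ)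
    (m : Fin k × Fin n → ℕ) : QMat A q k n :=
  ((List.finRange n).map fun j =>
    ((List.finRange k).map fun i => QMat.X A q k n i j ^ m (i, j)).prod).prod

namespace QMat

/-- Double sums over a linear order agree if the diagonal terms and the symmetrized
off-diagonal terms agree. -/
theorem sum_sum_eq_of_symmetrized {ι M : Type*} [Fintype ι] [LinearOrder ι]
    [AddCommGroup M] {f g : ι → ι → M} (hdiag : ∀ p, f p p = g p p)
    (hlt : ∀ p s, p < s → f p s + f s p = g p s + g s p) :
    ∑ p, ∑ s, f p s = ∑ p, ∑ s, g p s := by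
  rw [← sub_eq_zero]
  simp only [← Finset.sum_sub_distrib]
  rw [← Fintype.sum_prod_type' (f := fun p s => f p s - g p s)]
  refine Finset.sum_involution (fun x _ => x.swap) ?_ ?_ (by simp) (by simp)
  · rintro ⟨p, s⟩ -
    have key : f p s + f s p = g p s + g s p := by
      rcases lt_trichotomy p s with h | rfl | h
      · exact hlt p s h
      · rw [hdiag]
      · rw [add_comm (f p s), add_comm (g p s), hlt s p h]
    rw [Prod.swap_prod_mk, sub_add_sub_comm, key, sub_self]
  · rintro ⟨p, s⟩ - hne heq
    obtain rfl : s = p := congrArg Prod.fst heq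
    exact hne (sub_eq_zero.2 (hdiag s))

section Relations

variable {A : Type*} [CommRing A] {q : Aˣ} {k n : ℕ}

theorem X_mul_X_of_lt_of_gt {i r : Fin k} {j l : Fin n} (hir : i < r) (hlj : l < j) :
    X A q k n i j * X A q k n r l = X A q k n r l * X A q k n i j := by
  simpa only [map_mul, X] using
    RingQuot.mkAlgHom_rel A (QMatRel.comm (A := A) (q := q) i r j l (.inl ⟨hir, hlj⟩))

theorem X_mul_X_same_col {i r : Fin k} (j : Fin n) (hir : i < r) :
    X A q k n i j * X A q k n r j =
      ((q⁻¹ : Aˣ) : A) • (X A q k n r j * X A q k n i j) := by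
  simpa only [map_mul, map_smul, X] using
    RingQuot.mkAlgHom_rel A (QMatRel.qcomm (A := A) (q := q) i r j j (.inl ⟨hir, rfl⟩))

theorem X_mul_X_same_row (i : Fin k) {j l : Fin n} (hjl : j < l) :
    X A q k n i j * X A q k n i l =
      ((q⁻¹ : Aˣ) : A) • (X A q k n i l * X A q k n i j) := by
  simpa only [map_mul, map_smul, X] using
    RingQuot.mkAlgHom_rel A (QMatRel.qcomm (A := A) (q := q) i i j l (.inr ⟨rfl, hjl⟩))

theorem X_mul_X_of_lt_of_lt {i r : Fin k} {j l : Fin n} (hir : i < r) (hjl : j < l) :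
    X A q k n i j * X A q k n r l = X A q k n r l * X A q k n i j -
      ((q : A) - ((q⁻¹ : Aˣ) : A)) • (X A q k n r j * X A q k n i l) := by
  simpa only [map_mul, map_smul, map_sub, X] using
    RingQuot.mkAlgHom_rel A (QMatRel.cross (A := A) (q := q) i r j l ⟨hir, hjl⟩)

end Relations

/-- Two families of elements that satisfy the relations between two distinct rows, or
two distinct columns, of a quantum matrix. -/
structure QPair {A S ι : Type*} [CommRing A] [Ring S] [Algebra A S] [LT ι] (q : Aˣ)
    (a b : ι → S) : Prop where
  same (p : ι) : a p * b p = ((q⁻¹ : Aˣ) : A) • (b p * a p)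
  anti {p s : ι} (h : p < s) : a s * b p = b p * a s
  cross {p s : ι} (h : p < s) :
    a p * b s = b s * a p - ((q : A) - ((q⁻¹ : Aˣ) : A)) • (b p * a s)

/-- A family of elements that satisfies the relations within a single row, or a
single column, of a quantum matrix. -/
def QOrdered {A S ι : Type*} [CommRing A] [Ring S] [Algebra A S] [LT ι] (q : Aˣ)
    (a : ι → S) : Prop :=
  ∀ ⦃p s : ι⦄, p < s → a p * a s = ((q⁻¹ : Aˣ) : A) • (a s * a p)

section Generators

variable {A : Type*} [CommRing A] {q : Aˣ} {k n : ℕ}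

theorem qPair_row {i r : Fin k} (h : i < r) :
    QPair q (fun p => X A q k n i p) (fun p => X A q k n r p) where
  same p := X_mul_X_same_col p h
  anti hps := X_mul_X_of_lt_of_gt h hps
  cross hps := X_mul_X_of_lt_of_lt h hps

theorem qPair_col {j l : Fin n} (h : j < l) :
    QPair q (fun p => X A q k n p j) (fun p => X A q k n p l) where
  same p := X_mul_X_same_row p h
  anti hps := (X_mul_X_of_lt_of_gt hps h).symm
  cross hps := by
    rw [X_mul_X_of_lt_of_lt hps h, X_mul_X_of_lt_of_gt hps h]

theorem qOrdered_row (i : Fin k) : QOrdered q (fun p => X A q k n i p) :=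
  fun _ _ h => X_mul_X_same_row i h

theorem qOrdered_col (j : Fin n) : QOrdered q (fun p => X A q k n p j) :=
  fun _ _ h => X_mul_X_same_col j h

end Generators

open scoped TensorProduct

theorem sum_tmul_mul_sum_tmul {A S T ι : Type*} [CommRing A] [Ring S] [Algebra A S]
    [Ring T] [Algebra A T] [Fintype ι] (a b : ι → S) (c d : ι → T) :
    (∑ p, a p ⊗ₜ[A] c p) * ∑ p, b p ⊗ₜ[A] d p =
      ∑ p, ∑ s, (a p * b s) ⊗ₜ[A] (c p * d s) := by
  simp only [Finset.sum_mul_sum, Algebra.TensorProduct.tmul_mul_tmul]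

section TensorSums

variable {A S T ι : Type*} [CommRing A] [Ring S] [Algebra A S] [Ring T] [Algebra A T]
  [Fintype ι] [LinearOrder ι] {q : Aˣ} {a b : ι → S} {c d : ι → T}

theorem QOrdered.sum_tmul_qcomm (ha : QOrdered q a) (hcd : QPair q c d) :
    (∑ p, a p ⊗ₜ[A] c p) * ∑ p, a p ⊗ₜ[A] d p =
      ((q⁻¹ : Aˣ) : A) • ((∑ p, a p ⊗ₜ[A] d p) * ∑ p, a p ⊗ₜ[A] c p) := by
  simp only [sum_tmul_mul_sum_tmul, Finset.smul_sum]
  have hq := q.mul_inv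
  refine sum_sum_eq_of_symmetrized (fun p => ?_) fun p s h => ?_
  · rw [hcd.same, TensorProduct.tmul_smul]
  · rw [ha h, hcd.cross h, hcd.anti h]
    simp only [TensorProduct.tmul_sub, TensorProduct.tmul_smul,
      ← TensorProduct.smul_tmul']
    match_scalars
    · ring
    · linear_combination -hq

theorem QPair.sum_tmul_qcomm (hab : QPair q a b) (hc : QOrdered q c) :
    (∑ p, a p ⊗ₜ[A] c p) * ∑ p, b p ⊗ₜ[A] c p =
      ((q⁻¹ : Aˣ) : A) • ((∑ p, b p ⊗ₜ[A] c p) * ∑ p, a p ⊗ₜ[A] c p) := by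
  simp only [sum_tmul_mul_sum_tmul, Finset.smul_sum]
  have hq := q.mul_inv
  refine sum_sum_eq_of_symmetrized (fun p => ?_) fun p s h => ?_
  · rw [hab.same, TensorProduct.smul_tmul']
  · rw [hc h, hab.cross h, hab.anti h]
    simp only [TensorProduct.sub_tmul, TensorProduct.tmul_smul,
      ← TensorProduct.smul_tmul']
    match_scalars
    · ring
    · linear_combination -hq

theorem QPair.sum_tmul_comm (hab : QPair q a b) (hdc : QPair q d c) :
    (∑ p, a p ⊗ₜ[A] c p) * ∑ p, b p ⊗ₜ[A] d p =
      (∑ p, b p ⊗ₜ[A] d p) * ∑ p, a p ⊗ₜ[A] c p := by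
  simp only [sum_tmul_mul_sum_tmul]
  refine sum_sum_eq_of_symmetrized (fun p => ?_) fun p s h => ?_
  · rw [hab.same, hdc.same, TensorProduct.smul_tmul]
  · rw [hab.cross h, hab.anti h, hdc.cross h, hdc.anti h]
    simp only [TensorProduct.sub_tmul, TensorProduct.tmul_sub, TensorProduct.tmul_smul,
      ← TensorProduct.smul_tmul']
    module

theorem QPair.sum_tmul_cross (hab : QPair q a b) (hcd : QPair q c d) :
    (∑ p, a p ⊗ₜ[A] c p) * ∑ p, b p ⊗ₜ[A] d p =
      (∑ p, b p ⊗ₜ[A] d p) * (∑ p, a p ⊗ₜ[A] c p) -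
        ((q : A) - ((q⁻¹ : Aˣ) : A)) •
          ((∑ p, b p ⊗ₜ[A] c p) * ∑ p, a p ⊗ₜ[A] d p) := by
  simp only [sum_tmul_mul_sum_tmul, Finset.smul_sum, ← Finset.sum_sub_distrib]
  have hq := q.mul_inv
  refine sum_sum_eq_of_symmetrized (fun p => ?_) fun p s h => ?_
  · rw [hab.same, hcd.same]
    simp only [TensorProduct.tmul_smul, ← TensorProduct.smul_tmul']
    match_scalars
    linear_combination hq
  · rw [hab.cross h, hab.anti h, hcd.cross h, hcd.anti h]
    simp only [TensorProduct.sub_tmul, TensorProduct.tmul_sub, TensorProduct.tmul_smul,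
      ← TensorProduct.smul_tmul']
    module

end TensorSums

/-- The comultiplication `S_q(k,n) → S_q(k,l) ⊗ S_q(l,n)`. -/
noncomputable def comul (A : Type*) [CommRing A] (q : Aˣ) (k l n : ℕ) :
    QMat A q k n →ₐ[A] (QMat A q k l ⊗[A] QMat A q l n) :=
  RingQuot.liftAlgHom A
    ⟨FreeAlgebra.lift A fun x : Fin k × Fin n =>
      ∑ p : Fin l, X A q k l x.1 p ⊗ₜ[A] X A q l n p x.2, by
      intro x y hxy
      induction hxy with
      | comm i r j s h =>
        simp only [map_mul, FreeAlgebra.lift_ι_apply]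
        rcases h with ⟨hir, hsj⟩ | ⟨hri, hjs⟩
        · exact (qPair_row hir).sum_tmul_comm (qPair_col hsj)
        · exact ((qPair_row hri).sum_tmul_comm (qPair_col hjs)).symm
      | qcomm i r j s h =>
        simp only [map_mul, map_smul, FreeAlgebra.lift_ι_apply]
        rcases h with ⟨hir, rfl⟩ | ⟨rfl, hjs⟩
        · exact (qPair_row hir).sum_tmul_qcomm (qOrdered_col j)
        · exact (qOrdered_row i).sum_tmul_qcomm (qPair_col hjs)
      | cross i r j s h =>
        simp only [map_mul, map_smul, map_sub, FreeAlgebra.lift_ι_apply]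
        exact (qPair_row h.1).sum_tmul_cross (qPair_col h.2)⟩

theorem comul_X {A : Type*} [CommRing A] {q : Aˣ} {k l n : ℕ} (i : Fin k) (j : Fin n) :
    comul A q k l n (X A q k n i j) =
      ∑ p : Fin l, X A q k l i p ⊗ₜ[A] X A q l n p j := by
  rw [comul, X, RingQuot.liftAlgHom_mkAlgHom_apply, FreeAlgebra.lift_ι_apply]

theorem algHom_ext {A B : Type*} [CommRing A] [Semiring B] [Algebra A B] {q : Aˣ}
    {k n : ℕ} {f g : QMat A q k n →ₐ[A] B}
    (h : ∀ i j, f (X A q k n i j) = g (X A q k n i j)) : f = g :=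
  RingQuot.ringQuot_ext' A f g (FreeAlgebra.hom_ext (funext fun x => h x.1 x.2))

end QMat

open scoped TensorProduct in
/-- There is a unique `A`-algebra homomorphism
`Δ_{k,l,n} : S_q(k,n) → S_q(k,l) ⊗_A S_q(l,n)` with
`Δ_{k,l,n}(X_{ij}) = ∑_{l'} X_{il'} ⊗ X_{l'j}`. -/
theorem QMat.exists_unique_comultiplication
    (A : Type*) [CommRing A] (q : Aˣ) (k l n : ℕ)
    (hk : 1 ≤ k) (hl : 1 ≤ l) (hn : 1 ≤ n) :
    ∃! Δ : QMat A q k n →ₐ[A] (QMat A q k l ⊗[A] QMat A q l n),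
      ∀ (i : Fin k) (j : Fin n),
        Δ (QMat.X A q k n i j) =
          ∑ l' : Fin l, QMat.X A q k l i l' ⊗ₜ[A] QMat.X A q l n l' j := by
  refine ⟨QMat.comul A q k l n, QMat.comul_X, fun Δ hΔ => QMat.algHom_ext fun i j => ?_⟩
  rw [hΔ, QMat.comul_X]
end

section
/- For all μ₁, μ₂ ∈ ℕ and 0 ≤ i ≤ min(μ₁,μ₂): E v_i^{μ₁,μ₂} = [μ₂−i]·v_i^{μ₁+1,μ₂−1} (the right-hand side being 0 when i = μ₂), F v_i^{μ₁,μ₂} = [μ₁−i]·v_i^{μ₁−1,μ₂+1} (the right-hand side being 0 when i = μ₁), and H v_i^{μ₁,μ₂} = (μ₁−μ₂)·v_i^{μ₁,μ₂}. -/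
/-- The variable `q` in the field `ℚ(q)` of rational functions. -/
noncomputable def qq : RatFunc ℚ := RatFunc.X

/-- The quantum integer `[m] = ∑_{s=0}^{m-1} q^{m-1-2s} = (q^m - q^{-m})/(q - q^{-1})`. -/
noncomputable def qint (m : ℕ) : RatFunc ℚ :=
  ∑ s ∈ Finset.range m, qq ^ ((m : ℤ) - 1 - 2 * (s : ℤ))

/-- The quantum factorial `[m]! = [m][m-1]⋯[1]`. -/
noncomputable def qfact (m : ℕ) : RatFunc ℚ :=
  ∏ r ∈ Finset.range m, qint (r + 1)

/-- The quantum binomial coefficient `[m]!/([a]![m-a]!)`. -/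
noncomputable def qbinom (m a : ℕ) : RatFunc ℚ :=
  qfact m / (qfact a * qfact (m - a))

/-- The `ℚ(q)`-vector space with basis `X^m` indexed by the exponent functions
`m : Fin k × Fin 2 → ℕ` (rows `1,…,k` and two columns, 0-indexed). -/
abbrev Mmod (k : ℕ) := (Fin k × Fin 2 → ℕ) →₀ RatFunc ℚ

/-- The basis vector `X^m` of `Mmod k`. -/
noncomputable def Xb {k : ℕ} (m : Fin k × Fin 2 → ℕ) : Mmod k :=
  Finsupp.single m 1

/-- A linear operator on `Mmod k` defined by its values on the basis `X^m`. -/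
noncomputable def mkOp {k : ℕ} (f : (Fin k × Fin 2 → ℕ) → Mmod k) :
    Mmod k →ₗ[RatFunc ℚ] Mmod k :=
  Finsupp.lift (Mmod k) (RatFunc ℚ) (Fin k × Fin 2 → ℕ) f

/-- The exponent function `m + ε_p − ε_{p'}` (with truncated subtraction; in all
formulas below a term whose exponent function fails to be `ℕ`-valued carries a
vanishing coefficient `[0] = 0`). -/
def shiftExp {k : ℕ} (m : Fin k × Fin 2 → ℕ) (pup pdown : Fin k × Fin 2) :
    Fin k × Fin 2 → ℕ :=
  fun p => m p + (if p = pup then 1 else 0) - (if p = pdown then 1 else 0)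

/-- The highest weight vector
`v_i^{μ₁,μ₂} = ∑_{a=0}^{i} (−1)^a qbinom(i,a) q^{a(μ₂−a+1)} X^{m(a)}`, where
`m(a)_{1,1} = μ₁−i+a`, `m(a)_{2,1} = i−a`, `m(a)_{1,2} = μ₂−a`,
`m(a)_{2,2} = a` and `m(a)` vanishes on rows `≥ 3`. -/
noncomputable def vvec {k : ℕ} (hk : 2 ≤ k) (μ₁ μ₂ i : ℕ) : Mmod k :=
  ∑ a ∈ Finset.range (i + 1),
    ((-1) ^ a * qbinom i a * qq ^ (a * (μ₂ - a + 1))) •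
      Xb (fun p =>
        if p = ((⟨0, by omega⟩ : Fin k), (0 : Fin 2)) then μ₁ - i + a
        else if p = ((⟨1, by omega⟩ : Fin k), (0 : Fin 2)) then i - a
        else if p = ((⟨0, by omega⟩ : Fin k), (1 : Fin 2)) then μ₂ - a
        else if p = ((⟨1, by omega⟩ : Fin k), (1 : Fin 2)) then a
        else 0)

/-- The operator `E` of `U_q(sl₂)` acting columnwise on `Mmod k`:
`E X^m = ∑_i [m_{i,2}] (∏_{i' > i} q^{m_{i',1}−m_{i',2}}) X^{m+ε_{i,1}−ε_{i,2}}`. -/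
noncomputable def Eop (k : ℕ) : Mmod k →ₗ[RatFunc ℚ] Mmod k :=
  mkOp fun m =>
    ∑ i : Fin k,
      (qint (m (i, 1)) *
          ∏ i' : Fin k,
            if i < i' then qq ^ ((m (i', 0) : ℤ) - (m (i', 1) : ℤ)) else 1) •
        Xb (shiftExp m (i, 0) (i, 1))

/-- The operator `F` of `U_q(sl₂)` acting columnwise on `Mmod k`:
`F X^m = ∑_i [m_{i,1}] (∏_{i' < i} q^{−(m_{i',1}−m_{i',2})}) X^{m−ε_{i,1}+ε_{i,2}}`. -/
noncomputable def Fop (k : ℕ) : Mmod k →ₗ[RatFunc ℚ] Mmod k :=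
  mkOp fun m =>
    ∑ i : Fin k,
      (qint (m (i, 0)) *
          ∏ i' : Fin k,
            if i' < i then qq ^ (-((m (i', 0) : ℤ) - (m (i', 1) : ℤ))) else 1) •
        Xb (shiftExp m (i, 1) (i, 0))

/-- The operator `H`: `H X^m = (∑_i (m_{i,1} − m_{i,2})) X^m`. -/
noncomputable def Hop (k : ℕ) : Mmod k →ₗ[RatFunc ℚ] Mmod k :=
  mkOp fun m =>
    (((∑ i : Fin k, ((m (i, 0) : ℤ) - (m (i, 1) : ℤ))) : ℤ) : RatFunc ℚ) • Xb m

/-- The exponent function supported on the first two rows, with first column `(x, y)` and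
second column `(z, w)`. -/
def twoRowExp {k : ℕ} (hk : 2 ≤ k) (x y z w : ℕ) : Fin k × Fin 2 → ℕ := fun p =>
  if p = ((⟨0, by omega⟩ : Fin k), (0 : Fin 2)) then x
  else if p = ((⟨1, by omega⟩ : Fin k), (0 : Fin 2)) then y
  else if p = ((⟨0, by omega⟩ : Fin k), (1 : Fin 2)) then z
  else if p = ((⟨1, by omega⟩ : Fin k), (1 : Fin 2)) then w
  else 0

/-- The coefficient of the `a`-th basis vector in `vvec`. -/
noncomputable def vcoeff (μ₂ i a : ℕ) : RatFunc ℚ :=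
  (-1) ^ a * qbinom i a * qq ^ (a * (μ₂ - a + 1))

theorem vvec_eq_sum {k : ℕ} (hk : 2 ≤ k) (μ₁ μ₂ i : ℕ) :
    vvec hk μ₁ μ₂ i = ∑ a ∈ Finset.range (i + 1),
      vcoeff μ₂ i a • Xb (twoRowExp hk (μ₁ - i + a) (i - a) (μ₂ - a) a) := rfl

theorem qq_ne_zero : qq ≠ 0 := RatFunc.X_ne_zero

@[simp]
theorem qint_zero : qint 0 = 0 := by simp [qint]

theorem qint_succ (m : ℕ) : qint (m + 1) = qq ^ (-1 : ℤ) * qint m + qq ^ (m : ℤ) := by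
  rw [qint, Finset.sum_range_succ', qint, Finset.mul_sum]
  congr 1
  · refine Finset.sum_congr rfl fun s _ => ?_
    rw [← zpow_add₀ qq_ne_zero]
    congr 1
    push_cast
    ring
  · congr 1
    push_cast
    ring

theorem qint_mul_sub (m : ℕ) :
    qint m * (qq - qq⁻¹) = qq ^ (m : ℤ) - qq ^ (-(m : ℤ)) := by
  induction m with
  | zero => simp
  | succ m ih =>
    have hq := qq_ne_zero
    rw [qint_succ, add_mul, mul_assoc, ih]
    push_cast
    rw [neg_add, zpow_add₀ hq, zpow_add₀ hq]
    simp only [zpow_neg, zpow_one]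
    ring

theorem qq_pow_ne_one {n : ℕ} (hn : n ≠ 0) : qq ^ n ≠ 1 := by
  rw [qq, ← RatFunc.algebraMap_X, ← map_pow, ← map_one (algebraMap (Polynomial ℚ) (RatFunc ℚ))]
  intro h
  have := congrArg Polynomial.natDegree (RatFunc.algebraMap_injective ℚ h)
  simp [hn] at this

theorem qint_succ_ne_zero (m : ℕ) : qint (m + 1) ≠ 0 := by
  intro h
  have h' := qint_mul_sub (m + 1)
  rw [h, zero_mul, eq_comm, sub_eq_zero, zpow_neg, zpow_natCast] at h'
  have hq := pow_ne_zero (m + 1) qq_ne_zero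
  rw [← mul_eq_one_iff_eq_inv₀ hq, ← pow_add] at h'
  exact qq_pow_ne_one (by omega) h'

/-- The addition formula for quantum integers. -/
theorem qint_add (m n : ℕ) :
    qint (m + n) = qq ^ (n : ℤ) * qint m + qq ^ (-(m : ℤ)) * qint n := by
  induction n with
  | zero => simp
  | succ n ih =>
    rw [← add_assoc, qint_succ, ih, qint_succ]
    have hq := qq_ne_zero
    have h := qint_mul_sub m
    push_cast
    simp only [zpow_add₀ hq, zpow_neg, zpow_one] at h ⊢
    linear_combination (-(qq ^ (n : ℤ))) * h

theorem mkOp_Xb {k : ℕ} (f : (Fin k × Fin 2 → ℕ) → Mmod k) (m : Fin k × Fin 2 → ℕ) :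
    mkOp f (Xb m) = f m := by
  simp [mkOp, Xb]

theorem twoRowExp_row_zero {n : ℕ} (hk : 2 ≤ n + 2) (x y z w : ℕ) (c : Fin 2) :
    twoRowExp hk x y z w (0, c) = if c = 0 then x else z := by
  fin_cases c <;> simp [twoRowExp]

theorem twoRowExp_row_one {n : ℕ} (hk : 2 ≤ n + 2) (x y z w : ℕ) (c : Fin 2) :
    twoRowExp hk x y z w (1, c) = if c = 0 then y else w := by
  fin_cases c <;> simp [twoRowExp]

theorem twoRowExp_row_succ_succ {n : ℕ} (hk : 2 ≤ n + 2) (x y z w : ℕ) (r : Fin n)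
    (c : Fin 2) : twoRowExp hk x y z w (r.succ.succ, c) = 0 := by
  fin_cases c <;> simp [twoRowExp, Fin.ext_iff]

theorem Eop_twoRowExp {k : ℕ} (hk : 2 ≤ k) (x y z w : ℕ) :
    Eop k (Xb (twoRowExp hk x y z w)) =
      (qint z * qq ^ ((y : ℤ) - w)) • Xb (twoRowExp hk (x + 1) y (z - 1) w) +
        qint w • Xb (twoRowExp hk x (y + 1) z (w - 1)) := by
  obtain ⟨n, rfl⟩ := Nat.exists_eq_add_of_le' hk
  have h₁ : shiftExp (twoRowExp hk x y z w) (0, 0) (0, 1) =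
      twoRowExp hk (x + 1) y (z - 1) w := by
    ext ⟨r, c⟩
    refine Fin.cases ?_ (fun r => Fin.cases ?_ (fun r => ?_) r) r <;> fin_cases c <;>
      simp [shiftExp, twoRowExp, Fin.ext_iff]
  have h₂ : shiftExp (twoRowExp hk x y z w) (1, 0) (1, 1) =
      twoRowExp hk x (y + 1) z (w - 1) := by
    ext ⟨r, c⟩
    refine Fin.cases ?_ (fun r => Fin.cases ?_ (fun r => ?_) r) r <;> fin_cases c <;>
      simp [shiftExp, twoRowExp, Fin.ext_iff]
  rw [Eop, mkOp_Xb, Fin.sum_univ_succ, Fin.sum_univ_succ, Fin.succ_zero_eq_one, h₁, h₂]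
  simp [twoRowExp_row_zero, twoRowExp_row_one, twoRowExp_row_succ_succ,
    Fin.prod_univ_succ]

theorem Fop_twoRowExp {k : ℕ} (hk : 2 ≤ k) (x y z w : ℕ) :
    Fop k (Xb (twoRowExp hk x y z w)) =
      qint x • Xb (twoRowExp hk (x - 1) y (z + 1) w) +
        (qint y * qq ^ (-((x : ℤ) - z))) • Xb (twoRowExp hk x (y - 1) z (w + 1)) := by
  obtain ⟨n, rfl⟩ := Nat.exists_eq_add_of_le' hk
  have h₁ : shiftExp (twoRowExp hk x y z w) (0, 1) (0, 0) =
      twoRowExp hk (x - 1) y (z + 1) w := by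
    ext ⟨r, c⟩
    refine Fin.cases ?_ (fun r => Fin.cases ?_ (fun r => ?_) r) r <;> fin_cases c <;>
      simp [shiftExp, twoRowExp, Fin.ext_iff]
  have h₂ : shiftExp (twoRowExp hk x y z w) (1, 1) (1, 0) =
      twoRowExp hk x (y - 1) z (w + 1) := by
    ext ⟨r, c⟩
    refine Fin.cases ?_ (fun r => Fin.cases ?_ (fun r => ?_) r) r <;> fin_cases c <;>
      simp [shiftExp, twoRowExp, Fin.ext_iff]
  rw [Fop, mkOp_Xb, Fin.sum_univ_succ, Fin.sum_univ_succ, Fin.succ_zero_eq_one, h₁, h₂]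
  simp [twoRowExp_row_zero, twoRowExp_row_one, twoRowExp_row_succ_succ,
    Fin.prod_univ_succ]

theorem Hop_twoRowExp {k : ℕ} (hk : 2 ≤ k) (x y z w : ℕ) :
    Hop k (Xb (twoRowExp hk x y z w)) =
      (((x : ℤ) - z + (y - w) : ℤ) : RatFunc ℚ) • Xb (twoRowExp hk x y z w) := by
  obtain ⟨n, rfl⟩ := Nat.exists_eq_add_of_le' hk
  rw [Hop, mkOp_Xb, Fin.sum_univ_succ, Fin.sum_univ_succ]
  simp [twoRowExp, Fin.ext_iff]

theorem qfact_ne_zero (m : ℕ) : qfact m ≠ 0 :=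
  Finset.prod_ne_zero_iff.mpr fun r _ => qint_succ_ne_zero r

theorem qbinom_succ_mul_qint {i a : ℕ} (h : a < i) :
    qbinom i (a + 1) * qint (a + 1) = qbinom i a * qint (i - a) := by
  obtain ⟨b, rfl⟩ := Nat.exists_eq_add_of_lt h
  have hs (m : ℕ) : qfact (m + 1) = qfact m * qint (m + 1) := Finset.prod_range_succ _ _
  rw [qbinom, qbinom, show a + b + 1 - (a + 1) = b by omega,
    show a + b + 1 - a = b + 1 by omega, hs a, hs b]
  have := qfact_ne_zero a
  have := qfact_ne_zero b
  have := qint_succ_ne_zero a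
  have := qint_succ_ne_zero b
  field_simp

theorem vcoeff_eq_zpow {μ₂ i a : ℕ} (h : a ≤ μ₂) :
    vcoeff μ₂ i a = (-1) ^ a * qbinom i a * qq ^ ((a : ℤ) * (μ₂ - a + 1)) := by
  rw [vcoeff, show (a : ℤ) * (μ₂ - a + 1) = ((a * (μ₂ - a + 1) : ℕ) : ℤ) by
    push_cast [Nat.cast_sub h]; ring, zpow_natCast]

theorem vcoeff_mul_qint_self {μ₂ i : ℕ} (hi : i ≤ μ₂) :
    vcoeff μ₂ i i * (qint (μ₂ - i) * qq ^ (-(i : ℤ))) =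
      qint (μ₂ - i) * vcoeff (μ₂ - 1) i i := by
  obtain rfl | hlt := hi.eq_or_lt
  · simp
  · have hq := qq_ne_zero
    rw [vcoeff_eq_zpow hi, vcoeff_eq_zpow (by omega), Nat.cast_sub (by omega)]
    have : qq ^ ((i : ℤ) * (μ₂ - i + 1)) * qq ^ (-(i : ℤ)) =
        qq ^ ((i : ℤ) * (μ₂ - (1 : ℕ) - i + 1)) := by
      rw [← zpow_add₀ hq]
      congr 1
      push_cast
      ring
    rw [← this]
    ring

theorem vcoeff_mul_qint_add {μ₂ i a : ℕ} (ha : a < i) (hi : i ≤ μ₂) :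
    vcoeff μ₂ i a * (qint (μ₂ - a) * qq ^ (((i - a : ℕ) : ℤ) - a)) +
      vcoeff μ₂ i (a + 1) * qint (a + 1) = qint (μ₂ - i) * vcoeff (μ₂ - 1) i a := by
  have hq := qq_ne_zero
  have h := qbinom_succ_mul_qint ha
  obtain ⟨N, rfl⟩ := Nat.exists_eq_add_of_le ha.le
  obtain ⟨d, rfl⟩ := Nat.exists_eq_add_of_le hi
  rw [vcoeff_eq_zpow (by omega), vcoeff_eq_zpow (by omega), vcoeff_eq_zpow (by omega),
    Nat.cast_sub (by omega : 1 ≤ a + N + d)]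
  rw [Nat.add_sub_cancel_left] at h
  rw [show a + N + d - a = N + d by omega, Nat.add_sub_cancel_left, Nat.add_sub_cancel_left,
    qint_add]
  push_cast
  have h₁ : qq ^ ((a : ℤ) * (a + N + d - a + 1)) =
      qq ^ ((a : ℤ) * (a + N + d - 1 - a + 1)) * qq ^ (a : ℤ) := by
    rw [← zpow_add₀ hq]; congr 1; ring
  have h₂ : qq ^ (((a : ℤ) + 1) * (a + N + d - (a + 1) + 1)) =
      qq ^ ((a : ℤ) * (a + N + d - 1 - a + 1)) * (qq ^ (N : ℤ) * qq ^ (d : ℤ)) := by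
    rw [← zpow_add₀ hq, ← zpow_add₀ hq]; congr 1; ring
  rw [h₁, h₂, zpow_sub₀ hq, zpow_neg, pow_succ]
  generalize qq ^ ((a : ℤ) * (a + N + d - 1 - a + 1)) = R
  have hN := zpow_ne_zero (N : ℤ) hq
  have ha := zpow_ne_zero (a : ℤ) hq
  field_simp
  linear_combination (-R * qq ^ (N : ℤ) * qq ^ (d : ℤ)) * h

theorem vcoeff_succ_mul_qint_add {μ₂ i a : ℕ} (n : ℕ) (ha : a < i) (hi : i ≤ μ₂) :
    vcoeff μ₂ i (a + 1) * qint (n + (a + 1)) +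
      vcoeff μ₂ i a * (qint (i - a) * qq ^ (-(((n + a : ℕ) : ℤ) - (μ₂ - a : ℕ)))) =
      qint n * vcoeff (μ₂ + 1) i (a + 1) := by
  have hq := qq_ne_zero
  have h := qbinom_succ_mul_qint ha
  rw [vcoeff_eq_zpow (by omega), vcoeff_eq_zpow (by omega), vcoeff_eq_zpow (by omega),
    Nat.cast_sub (by omega : a ≤ μ₂), qint_add]
  push_cast
  have h₁ : qq ^ (((a : ℤ) + 1) * (μ₂ + 1 - (a + 1) + 1)) =
      qq ^ (((a : ℤ) + 1) * (μ₂ - (a + 1) + 1)) * qq ^ ((a : ℤ) + 1) := by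
    rw [← zpow_add₀ hq]; congr 1; ring
  have h₂ : qq ^ ((a : ℤ) * (μ₂ - a + 1)) * qq ^ (-((n : ℤ) + a - (μ₂ - a))) =
      qq ^ (((a : ℤ) + 1) * (μ₂ - (a + 1) + 1)) * qq ^ (-(n : ℤ)) := by
    rw [← zpow_add₀ hq, ← zpow_add₀ hq]; congr 1; ring
  rw [h₁, pow_succ]
  linear_combination (-1) ^ a * qbinom i a * qint (i - a) * h₂ -
    (-1) ^ a * qq ^ (((a : ℤ) + 1) * (μ₂ - (a + 1) + 1)) * qq ^ (-(n : ℤ)) * h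

theorem Eop_vvec {k : ℕ} (hk : 2 ≤ k) (μ₁ μ₂ i : ℕ) (hi₁ : i ≤ μ₁) (hi₂ : i ≤ μ₂) :
    Eop k (vvec hk μ₁ μ₂ i) = qint (μ₂ - i) • vvec hk (μ₁ + 1) (μ₂ - 1) i := by
  simp only [vvec_eq_sum, map_sum, map_smul, Eop_twoRowExp, smul_add, smul_smul,
    Finset.sum_add_distrib, Finset.smul_sum]
  rw [Finset.sum_range_succ, Finset.sum_range_succ'
    (fun a => (vcoeff μ₂ i a * qint a) • Xb (twoRowExp hk (μ₁ - i + a) (i - a + 1) _ (a - 1))),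
    Finset.sum_range_succ, qint_zero, mul_zero, zero_smul, add_zero, add_right_comm,
    ← Finset.sum_add_distrib]
  congr 1
  · refine Finset.sum_congr rfl fun a ha => ?_
    have ha := Finset.mem_range.mp ha
    rw [← vcoeff_mul_qint_add ha hi₂, add_smul]
    congr 4 <;> omega
  · rw [Nat.sub_self, Nat.cast_zero, zero_sub, vcoeff_mul_qint_self hi₂]
    congr 3 <;> omega

theorem Fop_vvec {k : ℕ} (hk : 2 ≤ k) (μ₁ μ₂ i : ℕ) (hi₁ : i ≤ μ₁) (hi₂ : i ≤ μ₂) :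
    Fop k (vvec hk μ₁ μ₂ i) = qint (μ₁ - i) • vvec hk (μ₁ - 1) (μ₂ + 1) i := by
  simp only [vvec_eq_sum, map_sum, map_smul, Fop_twoRowExp, smul_add, smul_smul,
    Finset.sum_add_distrib, Finset.smul_sum]
  rw [Finset.sum_range_succ', Finset.sum_range_succ, Finset.sum_range_succ',
    Nat.sub_self i, qint_zero, zero_mul, mul_zero, zero_smul, add_zero, add_zero, add_right_comm,
    ← Finset.sum_add_distrib]
  congr 1
  · refine Finset.sum_congr rfl fun a ha => ?_
    have ha := Finset.mem_range.mp ha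
    trans (qint (μ₁ - i) * vcoeff (μ₂ + 1) i (a + 1)) •
      Xb (twoRowExp hk (μ₁ - i + a) (i - (a + 1)) (μ₂ - a) (a + 1))
    · rw [← vcoeff_succ_mul_qint_add (μ₁ - i) ha hi₂, add_smul]
      congr 4
      omega
    · obtain rfl | hlt := hi₁.eq_or_lt
      · simp
      · congr 3 <;> omega
  · obtain rfl | hlt := hi₁.eq_or_lt
    · simp
    · rw [mul_comm, add_zero]
      congr 2
      simp [Nat.sub_right_comm]

theorem Hop_vvec {k : ℕ} (hk : 2 ≤ k) (μ₁ μ₂ i : ℕ) (hi₁ : i ≤ μ₁) (hi₂ : i ≤ μ₂) :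
    Hop k (vvec hk μ₁ μ₂ i) = ((((μ₁ : ℤ) - (μ₂ : ℤ)) : ℤ) : RatFunc ℚ) • vvec hk μ₁ μ₂ i := by
  rw [vvec_eq_sum, map_sum, Finset.smul_sum]
  refine Finset.sum_congr rfl fun a ha => ?_
  have ha := Finset.mem_range.mp ha
  rw [map_smul, Hop_twoRowExp, smul_comm]
  congr 2
  omega

/-- Action of the `U_q(sl₂)` operators `E`, `F`, `H` on the highest weight
vectors: `E v_i^{μ₁,μ₂} = [μ₂−i] v_i^{μ₁+1,μ₂−1}` (`0` when `i = μ₂`),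
`F v_i^{μ₁,μ₂} = [μ₁−i] v_i^{μ₁−1,μ₂+1}` (`0` when `i = μ₁`) and
`H v_i^{μ₁,μ₂} = (μ₁−μ₂) v_i^{μ₁,μ₂}`. -/
theorem EFH_on_vvec {k : ℕ} (hk : 2 ≤ k) (μ₁ μ₂ i : ℕ)
    (hi₁ : i ≤ μ₁) (hi₂ : i ≤ μ₂) :
    Eop k (vvec hk μ₁ μ₂ i) = qint (μ₂ - i) • vvec hk (μ₁ + 1) (μ₂ - 1) i ∧
    Fop k (vvec hk μ₁ μ₂ i) = qint (μ₁ - i) • vvec hk (μ₁ - 1) (μ₂ + 1) i ∧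
    Hop k (vvec hk μ₁ μ₂ i) =
      ((((μ₁ : ℤ) - (μ₂ : ℤ)) : ℤ) : RatFunc ℚ) • vvec hk μ₁ μ₂ i := by
  exact ⟨Eop_vvec hk μ₁ μ₂ i hi₁ hi₂, Fop_vvec hk μ₁ μ₂ i hi₁ hi₂, Hop_vvec hk μ₁ μ₂ i hi₁ hi₂⟩
end
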